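/- Let f : ℝⁿ → ℝ be C³ such that ‖∇f‖ is a constant c with c < 1, and define χᵢⱼ = ‖∇f‖² ∂ᵢ∂ⱼf + Δf (δᵢⱼ − ∂ᵢf ∂ⱼf). Then for every x ∈ ℝⁿ, Σᵢⱼ (∂ᵢ χᵢⱼ)(x) ∂ⱼf(x) ≤ 0; indeed Σᵢⱼ (∂ᵢ χᵢⱼ)(x) ∂ⱼf(x) = −‖Hess f(x)‖² − (Δf(x))² ‖∇f(x)‖². -/

import Mathlib

/-- The `i`-th partial derivative `∂ᵢ f` of a function `f : ℝⁿ → ℝ`. -/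
noncomputable def pd {n : ℕ} (f : (Fin n → ℝ) → ℝ) (i : Fin n) (x : Fin n → ℝ) : ℝ :=
  fderiv ℝ f x (Pi.single i 1)

/-- The second partial derivative `∂ᵢ ∂ⱼ f` (entry of the Hessian matrix). -/
noncomputable def pd2 {n : ℕ} (f : (Fin n → ℝ) → ℝ) (i j : Fin n) (x : Fin n → ℝ) : ℝ :=
  pd (pd f j) i x

/-- The squared gradient norm `‖∇f‖² = ∑ i, (∂ᵢ f)²`. -/
noncomputable def gradNormSq {n : ℕ} (f : (Fin n → ℝ) → ℝ) (x : Fin n → ℝ) : ℝ :=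
  ∑ i, pd f i x ^ 2

/-- The Euclidean Laplacian `Δf = ∑ i, ∂ᵢ ∂ᵢ f`. -/
noncomputable def lap {n : ℕ} (f : (Fin n → ℝ) → ℝ) (x : Fin n → ℝ) : ℝ :=
  ∑ i, pd2 f i i x

/-- The deformed metric `g̃ᵢⱼ = δᵢⱼ - ∂ᵢf ∂ⱼf` as a matrix. -/
noncomputable def gTilde {n : ℕ} (f : (Fin n → ℝ) → ℝ) (x : Fin n → ℝ) :
    Matrix (Fin n) (Fin n) ℝ :=
  1 - Matrix.vecMulVec (fun i => pd f i x) (fun i => pd f i x)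

/-- The Christoffel symbols `Γ̃ᵏᵢⱼ` of the metric `g̃` in Cartesian coordinates. -/
noncomputable def christoffel {n : ℕ} (f : (Fin n → ℝ) → ℝ) (k i j : Fin n)
    (x : Fin n → ℝ) : ℝ :=
  (1 / 2) * ∑ l, (gTilde f x)⁻¹ k l *
    (pd (fun y => gTilde f y j l) i x + pd (fun y => gTilde f y i l) j x
      - pd (fun y => gTilde f y i j) l x)

/-- The paper's symmetric tensor field
`χᵢⱼ = ‖∇f‖² ∂ᵢ∂ⱼf + Δf (δᵢⱼ - ∂ᵢf ∂ⱼf)` in Cartesian coordinates. -/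
noncomputable def chi {n : ℕ} (f : (Fin n → ℝ) → ℝ) (i j : Fin n) (x : Fin n → ℝ) : ℝ :=
  gradNormSq f x * pd2 f i j x
    + lap f x * ((if i = j then (1 : ℝ) else 0) - pd f i x * pd f j x)

/-- The divergence of the tensor field `χ` evaluated on a vector `V`:
`(div χ)(V) = ∑ i j, (∂ᵢ χᵢⱼ) Vⱼ`. -/
noncomputable def divChi {n : ℕ} (f : (Fin n → ℝ) → ℝ) (V : Fin n → ℝ)
    (x : Fin n → ℝ) : ℝ :=
  ∑ i, ∑ j, pd (fun y => chi f i j y) i x * V j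

section PartialDerivatives

variable {n : ℕ} {f g : (Fin n → ℝ) → ℝ} {x : Fin n → ℝ}

theorem pd_add (hf : DifferentiableAt ℝ f x) (hg : DifferentiableAt ℝ g x) (i : Fin n) :
    pd (fun y => f y + g y) i x = pd f i x + pd g i x := by
  simp [pd, fderiv_fun_add hf hg]

theorem pd_mul (hf : DifferentiableAt ℝ f x) (hg : DifferentiableAt ℝ g x) (i : Fin n) :
    pd (fun y => f y * g y) i x = pd f i x * g x + f x * pd g i x := by
  simp [pd, fderiv_fun_mul hf hg]
  ring

theorem pd_const_sub (a : ℝ) (f : (Fin n → ℝ) → ℝ) (i : Fin n) (x : Fin n → ℝ) :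
    pd (fun y => a - f y) i x = -pd f i x := by
  simp [pd, fderiv_const_sub]

theorem pd_const (a : ℝ) (i : Fin n) (x : Fin n → ℝ) :
    pd (fun _ => a) i x = 0 := by
  simp [pd]

theorem pd_sum {ι : Type*} (s : Finset ι) {F : ι → (Fin n → ℝ) → ℝ}
    (hF : ∀ k ∈ s, DifferentiableAt ℝ (F k) x) (i : Fin n) :
    pd (fun y => ∑ k ∈ s, F k y) i x = ∑ k ∈ s, pd (F k) i x := by
  simp [pd, fderiv_fun_sum hF]

theorem contDiff_pd {k m : WithTop ℕ∞} (hf : ContDiff ℝ k f) (hm : m + 1 ≤ k) (i : Fin n) :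
    ContDiff ℝ m (pd f i) :=
  (hf.fderiv_right hm).clm_apply contDiff_const

theorem pd_pd_eq_fderiv_fderiv (hf : ContDiff ℝ 2 f) (i j : Fin n) (x : Fin n → ℝ) :
    pd (pd f j) i x = fderiv ℝ (fderiv ℝ f) x (Pi.single i 1) (Pi.single j 1) := by
  have h : DifferentiableAt ℝ (fderiv ℝ f) x :=
    ((hf.fderiv_right (m := 1) (by norm_num)).differentiable (by norm_num)).differentiableAt
  change fderiv ℝ (fun y => fderiv ℝ f y (Pi.single j 1)) x (Pi.single i 1) = _
  rw [fderiv_clm_apply h (differentiableAt_const _)]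
  simp

theorem pd2_comm (hf : ContDiff ℝ 2 f) (i j : Fin n) : pd2 f i j = pd2 f j i := by
  funext x
  rw [pd2, pd2, pd_pd_eq_fderiv_fderiv hf, pd_pd_eq_fderiv_fderiv hf]
  exact (hf.contDiffAt.isSymmSndFDerivAt (by simp)).eq _ _

theorem pd_pd2_comm (hf : ContDiff ℝ 3 f) (i j : Fin n) (x : Fin n → ℝ) :
    pd (pd2 f i j) i x = pd (pd2 f i i) j x := by
  rw [pd2_comm (hf.of_le (by norm_num)) i j]
  exact congrFun (pd2_comm (contDiff_pd hf (m := 2) (by norm_num) i) i j) x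

theorem differentiable_pd (hf : ContDiff ℝ 2 f) (i : Fin n) : Differentiable ℝ (pd f i) :=
  (contDiff_pd hf (m := 1) (by norm_num) i).differentiable (by norm_num)

theorem differentiable_pd2 (hf : ContDiff ℝ 3 f) (i j : Fin n) :
    Differentiable ℝ (pd2 f i j) :=
  differentiable_pd (contDiff_pd hf (m := 2) (by norm_num) j) i

theorem differentiable_lap (hf : ContDiff ℝ 3 f) : Differentiable ℝ (lap f) :=
  Differentiable.fun_sum fun i _ => differentiable_pd2 hf i i

theorem sum_pd2_mul_pd_eq_zero (hf : ContDiff ℝ 2 f) {a : ℝ} (ha : ∀ y, gradNormSq f y = a)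
    (i : Fin n) (x : Fin n → ℝ) : ∑ j, pd2 f i j x * pd f j x = 0 := by
  have hd : ∀ j, DifferentiableAt ℝ (pd f j) x := fun j => differentiable_pd hf j x
  have h : pd (fun y => ∑ j, pd f j y * pd f j y) i x = 0 := by
    rw [← pd_const a i x]
    congr 1
    funext y
    simpa only [gradNormSq, sq] using ha y
  rw [pd_sum _ fun j _ => (hd j).fun_mul (hd j)] at h
  simp only [pd_mul (hd _) (hd _), mul_comm (pd f _ x) (pd (pd f _) i x), ← two_mul,
    ← Finset.mul_sum] at h
  simpa [pd2] using h

/-- Bochner's formula for a function on `ℝⁿ` whose gradient has constant norm. -/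
theorem sum_pd_lap_mul_pd (hf : ContDiff ℝ 3 f) {a : ℝ} (ha : ∀ y, gradNormSq f y = a)
    (x : Fin n → ℝ) :
    ∑ j, pd (lap f) j x * pd f j x = -∑ i, ∑ j, pd2 f i j x ^ 2 := by
  have hf2 : ContDiff ℝ 2 f := hf.of_le (by norm_num)
  have hd : ∀ j, DifferentiableAt ℝ (pd f j) x := fun j => differentiable_pd hf2 j x
  have hd2 : ∀ i j, DifferentiableAt ℝ (pd2 f i j) x := fun i j => differentiable_pd2 hf i j x
  have h : ∀ i, ∑ j, (pd (pd2 f i i) j x * pd f j x + pd2 f i j x ^ 2) = 0 := by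
    intro i
    have h0 : pd (fun y => ∑ j, pd2 f i j y * pd f j y) i x = 0 := by
      simp only [sum_pd2_mul_pd_eq_zero hf2 ha, pd_const]
    rw [pd_sum _ fun j _ => (hd2 i j).fun_mul (hd j)] at h0
    rw [← h0]
    refine Finset.sum_congr rfl fun j _ => ?_
    rw [pd_mul (hd2 i j) (hd j), pd_pd2_comm hf, sq]
    rfl
  have hlap : ∀ j, pd (lap f) j x = ∑ i, pd (pd2 f i i) j x := fun j =>
    pd_sum _ (fun i _ => hd2 i i) j
  simp only [hlap, Finset.sum_mul]
  rw [Finset.sum_comm, eq_neg_iff_add_eq_zero, ← Finset.sum_add_distrib]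
  exact Finset.sum_eq_zero fun i _ => by rw [← Finset.sum_add_distrib, h i]

theorem pd_chi (hf : ContDiff ℝ 3 f) {a : ℝ} (ha : ∀ y, gradNormSq f y = a)
    (i j : Fin n) (x : Fin n → ℝ) :
    pd (fun y => chi f i j y) i x = a * pd (pd2 f i i) j x
      + (pd (lap f) i x * ((if i = j then 1 else 0) - pd f i x * pd f j x)
        - lap f x * (pd2 f i i x * pd f j x + pd f i x * pd2 f i j x)) := by
  have hf2 : ContDiff ℝ 2 f := hf.of_le (by norm_num)
  have hd : ∀ j, DifferentiableAt ℝ (pd f j) x := fun j => differentiable_pd hf2 j x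
  have hd2 := differentiable_pd2 hf i j x
  have hl := differentiable_lap hf x
  have hm := (hd i).fun_mul (hd j)
  simp only [chi, ha]
  rw [pd_add (hd2.const_mul a) (hl.fun_mul (hm.const_sub _)),
    pd_mul (differentiableAt_const a) hd2, pd_mul hl (hm.const_sub _), pd_const_sub,
    pd_mul (hd i) (hd j), pd_const, pd_pd2_comm hf]
  simp only [pd2]
  ring

theorem divChi_grad (hf : ContDiff ℝ 3 f) {a : ℝ} (ha : ∀ y, gradNormSq f y = a)
    (x : Fin n → ℝ) :
    divChi f (fun j => pd f j x) x
      = -(∑ i, ∑ j, pd2 f i j x ^ 2) - lap f x ^ 2 * gradNormSq f x := by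
  have hf2 : ContDiff ℝ 2 f := hf.of_le (by norm_num)
  have hinner : ∀ i, ∑ j, pd (fun y => chi f i j y) i x * pd f j x
      = a * ∑ j, pd (pd2 f i i) j x * pd f j x + (1 - a) * (pd (lap f) i x * pd f i x)
        - lap f x * a * pd2 f i i x := by
    intro i
    have hterm : ∀ j, pd (fun y => chi f i j y) i x * pd f j x
        = a * (pd (pd2 f i i) j x * pd f j x)
          + pd (lap f) i x * (if i = j then pd f j x else 0)
          - (pd (lap f) i x * pd f i x + lap f x * pd2 f i i x) * pd f j x ^ 2
          - lap f x * pd f i x * (pd2 f i j x * pd f j x) := by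
      intro j
      rw [pd_chi hf ha]
      split_ifs <;> ring
    have hgrad : ∑ j, pd f j x ^ 2 = a := ha x
    simp only [hterm, Finset.sum_sub_distrib, Finset.sum_add_distrib, ← Finset.mul_sum,
      sum_pd2_mul_pd_eq_zero hf2 ha, hgrad, Finset.sum_ite_eq, Finset.mem_univ, if_true]
    ring
  have hB : ∑ i, ∑ j, pd (pd2 f i i) j x * pd f j x = -∑ i, ∑ j, pd2 f i j x ^ 2 := by
    rw [← sum_pd_lap_mul_pd hf ha, Finset.sum_comm]
    refine Finset.sum_congr rfl fun j _ => ?_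
    rw [← Finset.sum_mul]
    congr 1
    exact (pd_sum _ (fun i _ => differentiable_pd2 hf i i x) j).symm
  have hL : ∑ i, pd2 f i i x = lap f x := rfl
  simp only [divChi, hinner, Finset.sum_sub_distrib, Finset.sum_add_distrib, ← Finset.mul_sum,
    hB, sum_pd_lap_mul_pd hf ha, hL, ha]
  ring

end PartialDerivatives

/-- Flat-space case of Proposition 3.1: if `f : ℝⁿ → ℝ` is `C³` with `‖∇f‖` equal to a
constant `c < 1`, then `(div χ)(∇f) ≤ 0`; indeed
`(div χ)(∇f) = -‖Hess f‖² - (Δf)² ‖∇f‖²`. -/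
theorem stmt_12 {n : ℕ} (f : (Fin n → ℝ) → ℝ) (hf : ContDiff ℝ 3 f)
    (c : ℝ) (hc : c < 1) (hconst : ∀ x, Real.sqrt (gradNormSq f x) = c)
    (x : Fin n → ℝ) :
    divChi f (fun j => pd f j x) x ≤ 0 ∧
      divChi f (fun j => pd f j x) x
        = -(∑ i, ∑ j, pd2 f i j x ^ 2) - lap f x ^ 2 * gradNormSq f x := by
  have ha : ∀ y, gradNormSq f y = c ^ 2 := fun y => by
    have h0 : 0 ≤ gradNormSq f y := Finset.sum_nonneg fun i _ => sq_nonneg _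
    rw [← hconst y, Real.sq_sqrt h0]
  have h := divChi_grad hf ha x
  refine ⟨?_, h⟩
  have hH : 0 ≤ ∑ i, ∑ j, pd2 f i j x ^ 2 := by positivity
  have hG : 0 ≤ lap f x ^ 2 * gradNormSq f x := by rw [ha]; positivity
  linarith
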